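/- arXiv:2106.03137 — 6 statements merged into one kernel-verified Lean document; each statement's English description precedes it below -/
import Mathlib

section
/- Let C > 0 and let y : [0, ∞) → [0, ∞) be a differentiable function satisfying y'(t) ≤ C · y(t) · (1 + y(t))² for all t ≥ 0, and suppose that ∫₀^∞ y(t) dt < ∞. Then y(t) → 0 as t → ∞. -/
open MeasureTheory Filter

/-- A function that is monotone and bounded above on a half-line converges at infinity. -/
lemma exists_tendsto_atTop_of_monotoneOn_Ici {f : ℝ → ℝ} {a B : ℝ}
    (hf : MonotoneOn f (Set.Ici a)) (hB : ∀ t, a ≤ t → f t ≤ B) :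
    ∃ l, Tendsto f atTop (nhds l) := by
  have hmono : Monotone fun t => f (max t a) := fun s t hst =>
    hf (le_max_right s a) (le_max_right t a) (max_le_max_right a hst)
  have hbdd : BddAbove (Set.range fun t => f (max t a)) := by
    refine ⟨B, ?_⟩
    rintro _ ⟨t, rfl⟩
    exact hB _ (le_max_right t a)
  refine ⟨_, (tendsto_atTop_ciSup hmono hbdd).congr' ?_⟩
  filter_upwards [eventually_ge_atTop a] with t ht
  rw [max_eq_left ht]

/-- The limit at infinity of an integrable function on a half-line, if it exists, is zero. -/
lemma eq_zero_of_integrableOn_Ici_of_tendsto {f : ℝ → ℝ} {a l : ℝ}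
    (hf : IntegrableOn f (Set.Ici a)) (hl : Tendsto f atTop (nhds l)) : l = 0 := by
  refine IntegrableAtFilter.eq_zero_of_tendsto (μ := volume)
    ⟨Set.Ici a, Ici_mem_atTop a, hf⟩ (fun s hs => ?_) hl
  obtain ⟨b, hb⟩ := mem_atTop_sets.1 hs
  exact top_le_iff.1 (Real.volume_Ici (a := b) ▸ measure_mono hb)

/-- If `y : [0,∞) → [0,∞)` is differentiable with `y' ≤ C·y·(1+y)²` and
`∫₀^∞ y < ∞`, then `y(t) → 0` as `t → ∞`. -/
theorem q_flow_speed_tendsto_zero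
    (C : ℝ) (hC : 0 < C) (y : ℝ → ℝ)
    (hdiff : ∀ t, 0 ≤ t → DifferentiableAt ℝ y t)
    (hnonneg : ∀ t, 0 ≤ t → 0 ≤ y t)
    (hineq : ∀ t, 0 ≤ t → deriv y t ≤ C * y t * (1 + y t) ^ 2)
    (hint : IntegrableOn y (Set.Ici (0 : ℝ))) :
    Tendsto y atTop (nhds 0) := by
  have hpos : ∀ t, 0 ≤ t → 0 < 1 + y t := fun t ht => by linarith [hnonneg t ht]
  have hint' : IntegrableOn y (Set.Ioi 0) := hint.mono_set Set.Ioi_subset_Ici_self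
  have hcont : ContinuousOn y (Set.Ici 0) := fun t ht =>
    (hdiff t ht).continuousAt.continuousWithinAt
  have hii : ∀ t, 0 ≤ t → IntervalIntegrable y volume 0 t := fun t ht =>
    (intervalIntegrable_iff_integrableOn_Ioc_of_le ht).2
      (hint'.mono_set Set.Ioc_subset_Ioi_self)
  have hI : ∀ t, 0 < t → HasDerivAt (fun t => ∫ s in (0 : ℝ)..t, y s) (y t) t := fun t ht =>
    intervalIntegral.integral_hasDerivAt_right (hii t ht.le)
      ((hcont.mono Set.Ioi_subset_Ici_self).stronglyMeasurableAtFilter isOpen_Ioi t ht)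
      (hdiff t ht.le).continuousAt
  have hIcont : ContinuousOn (fun t => ∫ s in (0 : ℝ)..t, y s) (Set.Ici 0) := by
    intro t ht
    have h := intervalIntegral.continuousOn_primitive_interval' (hii (t + 1) (by grind))
      Set.left_mem_uIcc
    rw [Set.uIcc_of_le (by grind)] at h
    refine (h t ⟨ht, by linarith⟩).mono_of_mem_nhdsWithin ?_
    exact mem_nhdsWithin.2 ⟨Set.Iio (t + 1), isOpen_Iio, by simp, fun s hs => ⟨hs.2, hs.1.le⟩⟩
  have hGinv : ContinuousOn (fun t => (1 + y t)⁻¹) (Set.Ici 0) :=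
    (continuousOn_const.add hcont).inv₀ fun t ht => (hpos t ht).ne'
  have hmono : MonotoneOn (fun t => (1 + y t)⁻¹ + C * ∫ s in (0 : ℝ)..t, y s) (Set.Ici 0) := by
    have hderiv : ∀ t, 0 < t → HasDerivAt (fun t => (1 + y t)⁻¹ + C * ∫ s in (0 : ℝ)..t, y s)
        (-deriv y t / (1 + y t) ^ 2 + C * y t) t := fun t ht =>
      (((hdiff t ht.le).hasDerivAt.const_add 1).fun_inv (hpos t ht.le).ne').add
        ((hI t ht).const_mul C)
    refine monotoneOn_of_deriv_nonneg (convex_Ici 0)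
      (hGinv.add (continuousOn_const.mul hIcont)) ?_ ?_
    · intro t ht
      rw [interior_Ici] at ht
      exact (hderiv t ht).differentiableAt.differentiableWithinAt
    · intro t ht
      rw [interior_Ici] at ht
      rw [(hderiv t ht).deriv, neg_div, neg_add_eq_sub, sub_nonneg,
        div_le_iff₀ (pow_pos (hpos t (le_of_lt ht)) 2)]
      exact hineq t (le_of_lt ht)
  have hbound : ∀ t, 0 ≤ t →
      (1 + y t)⁻¹ + C * ∫ s in (0 : ℝ)..t, y s ≤ 1 + C * ∫ s in Set.Ioi 0, y s := by
    intro t ht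
    refine add_le_add (inv_le_one_of_one_le₀ (by linarith [hnonneg t ht]))
      (mul_le_mul_of_nonneg_left ?_ hC.le)
    rw [intervalIntegral.integral_of_le ht]
    exact setIntegral_mono_set hint'
      ((ae_restrict_mem measurableSet_Ioi).mono fun s hs => hnonneg s (le_of_lt hs))
      Set.Ioc_subset_Ioi_self.eventuallyLE
  obtain ⟨l, hl⟩ := exists_tendsto_atTop_of_monotoneOn_Ici hmono hbound
  have hlim : Tendsto (fun t => 1 - (1 + y t)⁻¹) atTop
      (nhds (1 - (l - C * ∫ s in Set.Ioi 0, y s))) := by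
    simpa using (hl.sub
      ((intervalIntegral_tendsto_integral_Ioi 0 hint' tendsto_id).const_mul C)).const_sub 1
  have hGint : IntegrableOn (fun t => 1 - (1 + y t)⁻¹) (Set.Ici 0) := by
    refine hint.mono' ((continuousOn_const.sub hGinv).aestronglyMeasurable measurableSet_Ici) ?_
    filter_upwards [ae_restrict_mem measurableSet_Ici] with t ht
    have h0 := hnonneg t ht
    have h1 : (1 + y t)⁻¹ ≤ 1 := inv_le_one_of_one_le₀ (by linarith)
    have h2 : 1 - (1 + y t)⁻¹ = y t / (1 + y t) := by
      have := (hpos t ht).ne'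
      field_simp
      ring
    rw [Real.norm_of_nonneg (by linarith), h2]
    exact div_le_self h0 (by linarith)
  rw [eq_zero_of_integrableOn_Ici_of_tendsto hGint hlim] at hlim
  have hfin : Tendsto (fun t => (1 - (1 - (1 + y t)⁻¹))⁻¹ - 1) atTop (nhds 0) := by
    simpa using ((hlim.const_sub 1).inv₀ (by norm_num)).sub_const 1
  simpa using hfin
end

section
/- Let n ≥ 2 be an even natural number and λ > 0. Define u : ℝⁿ → ℝ by u(x) = −log(1 + λ²‖x‖²). Then u is smooth and for every x ∈ ℝⁿ one has (−1)^{n/2} Δ^{n/2} u(x) = (n−1)! · (2λ)ⁿ · e^{n u(x)}, i.e. (−Δ)^{n/2} u(x) = (n−1)! (2λ)ⁿ / (1 + λ²‖x‖²)ⁿ, where Δ^{n/2} denotes the (n/2)-fold iterated Euclidean Laplacian Δ = Σᵢ ∂²/∂xᵢ². -/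
open scoped BigOperators

/-- The Euclidean Laplacian `Δ f = Σᵢ ∂²f/∂xᵢ²` of a function on `ℝⁿ`,
expressed via the second iterated Fréchet derivative in the coordinate
directions. -/
noncomputable def euclideanLaplacian {n : ℕ}
    (f : EuclideanSpace ℝ (Fin n) → ℝ) : EuclideanSpace ℝ (Fin n) → ℝ :=
  fun x => ∑ i : Fin n,
    iteratedFDeriv ℝ 2 f x ![EuclideanSpace.single i (1 : ℝ), EuclideanSpace.single i (1 : ℝ)]

open Finset

/-- The derivative of a radial function `φ(1 + a‖x‖²)`. -/
lemma hasFDerivAt_comp_one_add_mul_norm_sq {n : ℕ} {a d : ℝ} {φ : ℝ → ℝ}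
    {x : EuclideanSpace ℝ (Fin n)} (h : HasDerivAt φ d (1 + a * ‖x‖ ^ 2)) :
    HasFDerivAt (fun y : EuclideanSpace ℝ (Fin n) => φ (1 + a * ‖y‖ ^ 2))
      ((2 * a * d) • innerSL ℝ x) x := by
  have hw : HasFDerivAt (fun y : EuclideanSpace ℝ (Fin n) => 1 + a * ‖y‖ ^ 2)
      (a • (2 • innerSL ℝ x)) x :=
    (((hasStrictFDerivAt_norm_sq x).hasFDerivAt).const_mul a).const_add 1
  refine (h.comp_hasFDerivAt x hw).congr_fderiv ?_
  ext v
  simp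
  ring

/-- The Laplacian of a radial function `φ(1 + a‖x‖²)` with `0 ≤ a`. -/
lemma euclideanLaplacian_comp_one_add_mul_norm_sq {n : ℕ} {a : ℝ} (ha : 0 ≤ a)
    {φ φ' φ'' : ℝ → ℝ} (h : ∀ w, 0 < w → HasDerivAt φ (φ' w) w)
    (h' : ∀ w, 0 < w → HasDerivAt φ' (φ'' w) w) (x : EuclideanSpace ℝ (Fin n)) :
    euclideanLaplacian (fun y : EuclideanSpace ℝ (Fin n) => φ (1 + a * ‖y‖ ^ 2)) x =
      4 * a * (a * ‖x‖ ^ 2) * φ'' (1 + a * ‖x‖ ^ 2) +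
        2 * n * a * φ' (1 + a * ‖x‖ ^ 2) := by
  have hpos (y : EuclideanSpace ℝ (Fin n)) : 0 < 1 + a * ‖y‖ ^ 2 := by positivity
  have hf : fderiv ℝ (fun y : EuclideanSpace ℝ (Fin n) => φ (1 + a * ‖y‖ ^ 2)) =
      fun y => (2 * a * φ' (1 + a * ‖y‖ ^ 2)) • innerSL ℝ y :=
    funext fun y => (hasFDerivAt_comp_one_add_mul_norm_sq (h _ (hpos y))).fderiv
  have hf' := ((hasFDerivAt_comp_one_add_mul_norm_sq (h' _ (hpos x))).const_mul
    (2 * a)).fun_smul (innerSL ℝ (E := EuclideanSpace ℝ (Fin n))).hasFDerivAt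
  have hterm (i : Fin n) : iteratedFDeriv ℝ 2
      (fun y : EuclideanSpace ℝ (Fin n) => φ (1 + a * ‖y‖ ^ 2)) x
      ![EuclideanSpace.single i (1 : ℝ), EuclideanSpace.single i (1 : ℝ)] =
      2 * a * φ' (1 + a * ‖x‖ ^ 2) + 4 * a * a * φ'' (1 + a * ‖x‖ ^ 2) * x i ^ 2 := by
    rw [iteratedFDeriv_two_apply, hf, HasFDerivAt.fderiv hf']
    have hinner (y : EuclideanSpace ℝ (Fin n)) :
        innerSL ℝ y (EuclideanSpace.single i (1 : ℝ)) = y i := by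
      rw [innerSL_apply_apply, EuclideanSpace.inner_single_right]
      simp
    simp [hinner]
    ring
  simp only [euclideanLaplacian, hterm, sum_add_distrib, ← mul_sum, sum_const, card_univ,
    Fintype.card_fin, nsmul_eq_mul, ← EuclideanSpace.real_norm_sq_eq]
  ring

lemma hasDerivAt_inv_pow_of_pos (k : ℕ) {w : ℝ} (hw : 0 < w) :
    HasDerivAt (fun w : ℝ => w⁻¹ ^ k) (-k * w⁻¹ ^ (k + 1)) w := by
  refine ((hasDerivAt_inv hw.ne').pow k).congr_deriv ?_
  rcases k with _ | k
  · simp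
  · simp only [Nat.add_sub_cancel]
    rw [← inv_pow]
    ring

/-- The coefficient of `(1 + λ²‖x‖²)^{-(q+1+j)}` in `(-Δ)^{q+1} u / (4λ²)^{q+1}`, where `u` is the
standard bubble in dimension `2m`. -/
noncomputable def bubbleCoeff (m q j : ℕ) : ℝ :=
  (q + j).factorial * (q + 1).choose j * ∏ i ∈ range (q + 1 - j), ((m : ℝ) - j - 1 - i)

lemma bubbleCoeff_succ_zero (m q : ℕ) :
    bubbleCoeff m (q + 1) 0 = bubbleCoeff m q 0 * ((q + 1) * ((m : ℝ) - q - 2)) := by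
  simp only [bubbleCoeff, Nat.sub_zero, prod_range_succ _ (q + 1), add_zero, Nat.choose_zero_right,
    Nat.factorial_succ]
  push_cast
  ring

lemma bubbleCoeff_of_lt (m : ℕ) {q j : ℕ} (h : q + 1 < j) : bubbleCoeff m q j = 0 := by
  simp [bubbleCoeff, Nat.choose_eq_zero_of_lt h]

lemma bubbleCoeff_succ_succ (m : ℕ) {q j : ℕ} (hj : j ≤ q + 1) :
    bubbleCoeff m (q + 1) (j + 1) =
      bubbleCoeff m q (j + 1) * ((q + j + 2) * ((m : ℝ) - q - j - 3)) +
        bubbleCoeff m q j * ((q + j + 1) * (q + j + 2)) := by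
  rcases hj.eq_or_lt with rfl | hlt
  · rw [bubbleCoeff_of_lt m (Nat.lt_succ_self _)]
    simp only [bubbleCoeff, Nat.sub_self, prod_range_zero, Nat.choose_self]
    rw [show q + 1 + (q + 1 + 1) = q + (q + 1) + 1 + 1 by ring, Nat.factorial_succ,
      Nat.factorial_succ]
    push_cast
    ring
  · obtain ⟨d, hd⟩ := Nat.exists_eq_add_of_lt hlt
    obtain rfl : q = j + d := by omega
    have hc : ((j + d + 1).choose (j + 1) : ℝ) * (j + 1) = (j + d + 1).choose j * (d + 1) := by
      have := Nat.choose_succ_right_eq (j + d + 1) j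
      rw [show j + d + 1 - j = d + 1 by omega] at this
      exact_mod_cast this
    have h₁ : ∏ i ∈ range (d + 1), ((m : ℝ) - (j + 1 : ℕ) - 1 - i) =
        (∏ i ∈ range d, ((m : ℝ) - (j + 1 : ℕ) - 1 - i)) * (m - j - d - 2) := by
      rw [prod_range_succ]
      push_cast
      ring
    have h₂ : ∏ i ∈ range (d + 1), ((m : ℝ) - j - 1 - i) =
        (∏ i ∈ range d, ((m : ℝ) - (j + 1 : ℕ) - 1 - i)) * (m - j - 1) := by
      rw [prod_range_succ']
      push_cast
      congr 1
      · exact prod_congr rfl fun i _ => by ring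
      · ring
    simp only [bubbleCoeff]
    rw [show j + d + 1 + 1 - (j + 1) = d + 1 by omega, show j + d + 1 - (j + 1) = d by omega,
      show j + d + 1 - j = d + 1 by omega, h₁, h₂, Nat.choose_succ_succ,
      show j + d + 1 + (j + 1) = j + d + j + 1 + 1 by ring,
      show j + d + (j + 1) = j + d + j + 1 by ring, Nat.factorial_succ (j + d + j + 1),
      Nat.factorial_succ (j + d + j)]
    generalize ∏ i ∈ range d, ((m : ℝ) - (j + 1 : ℕ) - 1 - i) = P
    push_cast
    linear_combination (P * (j + d + j).factorial * (j + d + j + 1) * (j + d + j + 2)) * hc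

lemma sum_bubbleCoeff_succ (m q : ℕ) (X : ℝ) :
    ∑ j ∈ range (q + 3), bubbleCoeff m (q + 1) j * X ^ j =
      ∑ j ∈ range (q + 2), bubbleCoeff m q j *
        ((q + j + 1) * ((m : ℝ) - q - j - 2) * X ^ j + (q + j + 1) * (q + j + 2) * X ^ (j + 1)) := by
  have hlast := bubbleCoeff_of_lt m (Nat.lt_succ_self (q + 1))
  have hshift : ∑ j ∈ range (q + 2), bubbleCoeff m q j *
      ((q + j + 1) * ((m : ℝ) - q - j - 2) * X ^ j) =
      ∑ j ∈ range (q + 3), bubbleCoeff m q j *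
        ((q + j + 1) * ((m : ℝ) - q - j - 2) * X ^ j) := by
    rw [sum_range_succ _ (q + 2), hlast, zero_mul, add_zero]
  simp only [mul_add, sum_add_distrib]
  simp only [← mul_add, hshift]
  rw [sum_range_succ' _ (q + 2), sum_range_succ' _ (q + 2), add_right_comm, ← sum_add_distrib,
    bubbleCoeff_succ_zero]
  congr 1
  · refine sum_congr rfl fun j hj => ?_
    rw [bubbleCoeff_succ_succ m (Nat.lt_succ_iff.mp (mem_range.mp hj))]
    push_cast
    ring
  · push_cast
    ring

lemma iterate_euclideanLaplacian_bubble (m : ℕ) {a : ℝ} (ha : 0 ≤ a) (q : ℕ) :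
    euclideanLaplacian^[q + 1]
        (fun x : EuclideanSpace ℝ (Fin (m + m)) => -Real.log (1 + a * ‖x‖ ^ 2)) =
      fun x => (fun w : ℝ => ∑ j ∈ range (q + 2),
        (-4 * a) ^ (q + 1) * bubbleCoeff m q j * w⁻¹ ^ (q + 1 + j)) (1 + a * ‖x‖ ^ 2) := by
  induction q with
  | zero =>
    funext x
    have hw : 0 < 1 + a * ‖x‖ ^ 2 := by positivity
    rw [zero_add, Function.iterate_one, euclideanLaplacian_comp_one_add_mul_norm_sq ha
      (φ := fun w => -Real.log w) (φ' := fun w => -w⁻¹) (φ'' := fun w => -(-(w ^ 2)⁻¹))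
      (fun w hw => (Real.hasDerivAt_log hw.ne').neg) (fun w hw => (hasDerivAt_inv hw.ne').neg)]
    simp [sum_range_succ, bubbleCoeff]
    field_simp
    ring
  | succ q ih =>
    funext x
    have hw : 0 < 1 + a * ‖x‖ ^ 2 := by positivity
    rw [Function.iterate_succ_apply', ih, euclideanLaplacian_comp_one_add_mul_norm_sq ha
      (fun w hw => HasDerivAt.fun_sum fun j _ => (hasDerivAt_inv_pow_of_pos (q + 1 + j) hw).const_mul
        ((-4 * a) ^ (q + 1) * bubbleCoeff m q j))
      (fun w hw => HasDerivAt.fun_sum fun j _ =>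
        ((hasDerivAt_inv_pow_of_pos (q + 1 + j + 1) hw).const_mul
          (-((q + 1 + j : ℕ) : ℝ))).const_mul ((-4 * a) ^ (q + 1) * bubbleCoeff m q j))]
    obtain ⟨w, hwx⟩ : ∃ w, w = 1 + a * ‖x‖ ^ 2 := ⟨_, rfl⟩
    rw [← hwx] at hw ⊢
    beta_reduce
    have hX : (a * ‖x‖ ^ 2) * w⁻¹ = 1 - w⁻¹ := by
      rw [show a * ‖x‖ ^ 2 = w - 1 by linarith]
      field_simp
    generalize w⁻¹ = X at hX ⊢
    have hR : ∑ j ∈ range (q + 1 + 2), (-4 * a) ^ (q + 1 + 1) * bubbleCoeff m (q + 1) j *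
        X ^ (q + 1 + 1 + j) = (-4 * a) ^ (q + 2) * X ^ (q + 2) *
          ∑ j ∈ range (q + 3), bubbleCoeff m (q + 1) j * X ^ j := by
      rw [mul_sum]
      exact sum_congr rfl fun j _ => by ring
    rw [hR, sum_bubbleCoeff_succ, mul_sum, mul_sum, mul_sum, ← sum_add_distrib]
    refine sum_congr rfl fun j _ => ?_
    push_cast
    linear_combination (4 * a * ((-4 * a) ^ (q + 1) * bubbleCoeff m q j) * (q + 1 + j) *
      (q + 1 + j + 1) * X ^ (q + 1 + j + 1)) * hX

lemma bubbleCoeff_self (q : ℕ) : bubbleCoeff (q + 1) q (q + 1) = (2 * q + 1).factorial := by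
  simp [bubbleCoeff, two_mul, add_assoc]

lemma bubbleCoeff_eq_zero {q j : ℕ} (hj : j ≤ q) : bubbleCoeff (q + 1) q j = 0 := by
  refine mul_eq_zero_of_right _ (prod_eq_zero (i := q - j) (mem_range.mpr (by omega)) ?_)
  rw [Nat.cast_sub hj]
  push_cast
  ring

/-- The standard bubble `u(x) = −log(1+λ²‖x‖²)` is smooth and solves the
polyharmonic Liouville equation `(−Δ)^{n/2} u = (n−1)!(2λ)ⁿ e^{nu}` on `ℝⁿ`. -/
theorem standard_bubble_solves_liouville
    (n : ℕ) (hn : 2 ≤ n) (hne : Even n) (lam : ℝ) (hlam : 0 < lam) :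
    ContDiff ℝ (⊤ : ℕ∞) (fun x : EuclideanSpace ℝ (Fin n) => -Real.log (1 + lam ^ 2 * ‖x‖ ^ 2)) ∧
    ∀ x : EuclideanSpace ℝ (Fin n),
      (-1 : ℝ) ^ (n / 2) *
        (euclideanLaplacian^[n / 2]
          (fun x : EuclideanSpace ℝ (Fin n) => -Real.log (1 + lam ^ 2 * ‖x‖ ^ 2))) x
      = (Nat.factorial (n - 1) : ℝ) * (2 * lam) ^ n *
          Real.exp (n * (-Real.log (1 + lam ^ 2 * ‖x‖ ^ 2))) := by
  have hpos (x : EuclideanSpace ℝ (Fin n)) : 0 < 1 + lam ^ 2 * ‖x‖ ^ 2 := by positivity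
  refine ⟨((contDiff_const.add (contDiff_const.mul (contDiff_norm_sq ℝ))).log
    fun x => (hpos x).ne').neg, fun x => ?_⟩
  obtain ⟨m, rfl⟩ := hne
  obtain ⟨q, rfl⟩ : ∃ q, m = q + 1 := ⟨m - 1, by omega⟩
  rw [show (q + 1 + (q + 1)) / 2 = q + 1 by omega,
    iterate_euclideanLaplacian_bubble (q + 1) (sq_nonneg lam) q]
  beta_reduce
  rw [sum_range_succ, sum_eq_zero fun j hj => by
      rw [bubbleCoeff_eq_zero (Nat.lt_succ_iff.mp (mem_range.mp hj)), mul_zero, zero_mul],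
    zero_add, bubbleCoeff_self, show q + 1 + (q + 1) - 1 = 2 * q + 1 by omega, Real.exp_nat_mul,
    Real.exp_neg, Real.exp_log (hpos x), ← mul_assoc, ← mul_assoc, ← mul_pow,
    show (2 * lam) ^ (q + 1 + (q + 1)) = (-1 * (-4 * lam ^ 2)) ^ (q + 1) by
      rw [pow_add, ← mul_pow]
      ring]
  ring
end

section
/- Let (X, μ) be a probability measure space and let f : X → [0, ∞) be measurable with ∫_X f dμ = 1, such that f log f is μ-integrable with ∫_X f log f dμ ≤ C₁ for some C₁ ≥ 0. Then μ({x ∈ X : f(x) ≥ 1/2}) ≥ exp(−2(C₁ + 2/e)). -/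
open MeasureTheory

/-- The tangent line of `y ↦ y log y` at `c > 0` lies below its graph on `[0, ∞)`. -/
lemma tangent_le_mul_log {c y : ℝ} (hc : 0 < c) (hy : 0 ≤ y) :
    (1 + Real.log c) * y - c ≤ y * Real.log y := by
  rcases hy.eq_or_lt with rfl | hy
  · simp [hc.le]
  · have h := Real.log_le_sub_one_of_pos (div_pos hc hy)
    rw [Real.log_div hc.ne' hy.ne'] at h
    have h2 := mul_le_mul_of_nonneg_left h hy.le
    have h3 : y * (c / y - 1) = c - y := by field_simp
    linarith

lemma neg_exp_neg_one_le_mul_log {y : ℝ} (hy : 0 ≤ y) :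
    -Real.exp (-1) ≤ y * Real.log y := by
  simpa using tangent_le_mul_log (Real.exp_pos (-1)) hy

/-- Jensen's inequality for `y ↦ y log y` on a set, in unnormalized form. -/
lemma mul_log_div_le_setIntegral_mul_log {X : Type*} [MeasurableSpace X] {μ : Measure X}
    [IsFiniteMeasure μ] {f : X → ℝ} {A : Set X} (hnn : ∀ x, 0 ≤ f x)
    (hf : IntegrableOn f A μ) (hent : IntegrableOn (fun x => f x * Real.log (f x)) A μ)
    (hA : 0 < μ.real A) (hM : 0 < ∫ x in A, f x ∂μ) :
    (∫ x in A, f x ∂μ) * Real.log ((∫ x in A, f x ∂μ) / μ.real A)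
      ≤ ∫ x in A, f x * Real.log (f x) ∂μ := by
  set M := ∫ x in A, f x ∂μ with hMdef
  have h : ∫ x in A, ((1 + Real.log (M / μ.real A)) * f x - M / μ.real A) ∂μ
      ≤ ∫ x in A, f x * Real.log (f x) ∂μ :=
    integral_mono ((hf.const_mul _).sub (integrable_const _)) hent
      fun x => tangent_le_mul_log (div_pos hM hA) (hnn x)
  rw [integral_sub (hf.const_mul _) (integrable_const _), integral_const_mul,
    setIntegral_const, smul_eq_mul, mul_div_cancel₀ _ hA.ne', ← hMdef] at h
  linarith

/-- If `f ≥ 0` on a probability space has `∫ f = 1` and entropy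
`∫ f log f ≤ C₁`, then the set `{f ≥ 1/2}` has measure at least
`exp(−2(C₁ + 2/e))`. -/
theorem measure_of_large_set_lower_bound
    {X : Type*} [MeasurableSpace X] (μ : Measure X) [IsProbabilityMeasure μ]
    (f : X → ℝ) (hf : Measurable f) (hnn : ∀ x, 0 ≤ f x)
    (hmass : ∫ x, f x ∂μ = 1)
    (C₁ : ℝ) (hC₁ : 0 ≤ C₁)
    (hent_int : Integrable (fun x => f x * Real.log (f x)) μ)
    (hent : ∫ x, f x * Real.log (f x) ∂μ ≤ C₁) :
    ENNReal.ofReal (Real.exp (-2 * (C₁ + 2 / Real.exp 1)))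
      ≤ μ {x | 1 / 2 ≤ f x} := by
  set A : Set X := {x | 1 / 2 ≤ f x} with hAdef
  have hA : MeasurableSet A := measurableSet_le measurable_const hf
  have hfi : Integrable f μ := .of_integral_ne_zero (by simp [hmass])
  have hsplit := integral_add_compl hA hfi
  have hsplit_ent := integral_add_compl hA hent_int
  have hcompl : ∫ x in Aᶜ, f x ∂μ ≤ 1 / 2 := by
    have h : ∫ x in Aᶜ, f x ∂μ ≤ ∫ _ in Aᶜ, (1 / 2 : ℝ) ∂μ :=
      setIntegral_mono_on hfi.integrableOn (integrable_const _) hA.compl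
        fun x hx => (not_le.mp (show ¬ 1 / 2 ≤ f x from hx)).le
    rw [setIntegral_const, smul_eq_mul] at h
    linarith [measureReal_le_one (μ := μ) (s := Aᶜ)]
  have hcompl_ent : -Real.exp (-1) ≤ ∫ x in Aᶜ, f x * Real.log (f x) ∂μ := by
    have h : ∫ _ in Aᶜ, -Real.exp (-1) ∂μ ≤ ∫ x in Aᶜ, f x * Real.log (f x) ∂μ :=
      integral_mono (integrable_const _) hent_int.integrableOn
        fun x => neg_exp_neg_one_le_mul_log (hnn x)
    rw [setIntegral_const, smul_eq_mul] at h
    nlinarith [measureReal_le_one (μ := μ) (s := Aᶜ), Real.exp_pos (-1)]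
  have hM : 1 / 2 ≤ ∫ x in A, f x ∂μ := by linarith
  have hm : 0 < μ.real A := by
    refine measureReal_nonneg.lt_of_ne fun h => ?_
    rw [setIntegral_measure_zero _ ((measureReal_eq_zero_iff).mp h.symm)] at hM
    norm_num at hM
  have hjensen := mul_log_div_le_setIntegral_mul_log hnn hfi.integrableOn
    hent_int.integrableOn hm (by linarith)
  rw [Real.log_div (by linarith) hm.ne'] at hjensen
  have hMlog := neg_exp_neg_one_le_mul_log (y := ∫ x in A, f x ∂μ) (by linarith)
  have hlog : Real.log (μ.real A) ≤ 0 := Real.log_nonpos hm.le measureReal_le_one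
  have he : 2 / Real.exp 1 = 2 * Real.exp (-1) := by rw [Real.exp_neg, div_eq_mul_inv]
  have key : -2 * (C₁ + 2 / Real.exp 1) ≤ Real.log (μ.real A) := by
    rw [he]
    nlinarith [mul_nonneg (sub_nonneg.mpr hM) (neg_nonneg.mpr hlog)]
  rw [← ofReal_measureReal]
  exact ENNReal.ofReal_le_ofReal ((Real.le_log_iff_exp_le hm).mp key)
end

section
/- Let a ∈ ℝ, E∞ ∈ ℝ, θ ∈ [1/2, 1), C > 0, and let E : [a, ∞) → ℝ be differentiable with E'(t) ≤ 0 and E(t) ≥ E∞ for all t ≥ a, satisfying the Łojasiewicz-type inequality (E(t) − E∞)^θ ≤ C · (−E'(t))^{1/2} for all t ≥ a. Then ∫_a^∞ (−E'(t))^{1/2} dt ≤ (C/(1−θ)) · (E(a) − E∞)^{1−θ}. -/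
open MeasureTheory

open Set Filter Topology in
/-- A nonnegative measurable function dominated by the derivative of a bounded monotone function
is integrable, and its integral is at most the total increase allowed by the bound. -/
theorem integrableOn_Ioi_and_integral_le_of_le_deriv {f G : ℝ → ℝ} {a M : ℝ}
    (hf : Measurable f) (hf0 : ∀ t, 0 ≤ f t) (hG : MonotoneOn G (Ici a))
    (hM : ∀ t, a ≤ t → G t ≤ M) (hfG : ∀ t, a < t → f t ≤ deriv G t) :
    IntegrableOn f (Ioi a) ∧ ∫ t in Ioi a, f t ≤ M - G a := by
  have hmono {b : ℝ} (hb : a ≤ b) : MonotoneOn G (uIcc a b) :=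
    hG.mono (uIcc_of_le hb ▸ Icc_subset_Ici_self)
  have hderiv {b : ℝ} (hb : a ≤ b) : IntegrableOn (deriv G) (Ioc a b) :=
    (intervalIntegrable_iff_integrableOn_Ioc_of_le hb).1 (hmono hb).intervalIntegrable_deriv
  have hint (b : ℝ) : IntegrableOn f (Ioc a b) := by
    rcases le_or_gt a b with hb | hb
    · refine (hderiv hb).mono' hf.aestronglyMeasurable ?_
      filter_upwards [ae_restrict_mem measurableSet_Ioc] with t ht
      rw [Real.norm_of_nonneg (hf0 t)]
      exact hfG t ht.1
    · simp [Ioc_eq_empty hb.le.not_gt]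
  have hbound : ∀ᶠ b in atTop, ∫ t in a..b, f t ≤ M - G a := by
    filter_upwards [eventually_ge_atTop a] with b hb
    have hGab : G a ≤ G b := hG self_mem_Ici hb hb
    have hFTC := (hmono hb).intervalIntegral_deriv_mem_uIcc
    rw [uIcc_of_le (sub_nonneg.2 hGab), intervalIntegral.integral_of_le hb] at hFTC
    rw [intervalIntegral.integral_of_le hb]
    have hle := setIntegral_mono_on (hint b) (hderiv hb) measurableSet_Ioc
      fun t ht => hfG t ht.1
    linarith [hFTC.2, hM b hb]
  have hfi : IntegrableOn f (Ioi a) := by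
    refine integrableOn_Ioi_of_intervalIntegral_norm_bounded (M - G a) a hint tendsto_id ?_
    simpa only [Real.norm_of_nonneg (hf0 _), id] using hbound
  exact ⟨hfi, le_of_tendsto (intervalIntegral_tendsto_integral_Ioi a hfi tendsto_id) hbound⟩

open Set Filter Topology in
/-- The Łojasiewicz inequality `F ^ θ ≤ C √(-F')` for a nonnegative `F` bounds the speed
`√(-F')` by the decay rate of `C / (1 - θ) * F ^ (1 - θ)`, also at zeros of `F`. -/
theorem sqrt_neg_deriv_le_deriv_neg_rpow {F : ℝ → ℝ} {t θ C : ℝ} (hθ : θ < 1) (hC : 0 < C)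
    (hdiff : DifferentiableAt ℝ F t) (hdec : deriv F t ≤ 0) (hpos : ∀ᶠ s in 𝓝 t, 0 ≤ F s)
    (hloj : F t ^ θ ≤ C * Real.sqrt (-deriv F t)) :
    Real.sqrt (-deriv F t) ≤ deriv (fun s => -(C / (1 - θ) * F s ^ (1 - θ))) t := by
  have hθ' : 0 < 1 - θ := sub_pos.2 hθ
  rcases hpos.self_of_nhds.eq_or_lt with h0 | h0
  · have hF : deriv F t = 0 := IsLocalMin.deriv_eq_zero (by
      filter_upwards [hpos] with s hs
      rwa [← h0])
    have hG : deriv (fun s => -(C / (1 - θ) * F s ^ (1 - θ))) t = 0 :=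
      IsLocalMax.deriv_eq_zero (by
        filter_upwards [hpos] with s hs
        rw [← h0, Real.zero_rpow hθ'.ne', mul_zero, neg_zero, neg_nonpos]
        positivity)
    rw [hF, hG, neg_zero, Real.sqrt_zero]
  · have hG := ((hdiff.hasDerivAt.rpow_const (p := 1 - θ) (.inl h0.ne')).const_mul
      (C / (1 - θ))).neg
    have hpow : 0 < F t ^ θ := Real.rpow_pos_of_pos h0 θ
    have hsq := Real.mul_self_sqrt (neg_nonneg.2 hdec)
    have hval : -(C / (1 - θ) * (deriv F t * (1 - θ) * F t ^ (1 - θ - 1)))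
        = C * (-deriv F t) / F t ^ θ := by
      rw [show 1 - θ - 1 = -θ by ring, Real.rpow_neg h0.le]
      field_simp
    refine le_of_le_of_eq ?_ (hval.symm.trans hG.deriv.symm)
    rw [le_div_iff₀ hpow]
    nlinarith [mul_le_mul_of_nonneg_left hloj (Real.sqrt_nonneg (-deriv F t))]

/-- Łojasiewicz-type lemma: if `E` is nonincreasing, bounded below by `Einf`,
and `(E(t) − Einf)^θ ≤ C (−E'(t))^{1/2}` for all `t ≥ a`, then the flow speed
`(−E')^{1/2}` is integrable on `[a,∞)` with
`∫_a^∞ (−E')^{1/2} ≤ (C/(1−θ)) (E(a) − Einf)^{1−θ}`. -/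
theorem lojasiewicz_integral_bound
    (a Einf θ C : ℝ) (hθ : θ ∈ Set.Ico (1 / 2 : ℝ) 1) (hC : 0 < C)
    (E : ℝ → ℝ)
    (hdiff : ∀ t, a ≤ t → DifferentiableAt ℝ E t)
    (hdec : ∀ t, a ≤ t → deriv E t ≤ 0)
    (hlow : ∀ t, a ≤ t → Einf ≤ E t)
    (hloj : ∀ t, a ≤ t → (E t - Einf) ^ θ ≤ C * Real.sqrt (-deriv E t)) :
    IntegrableOn (fun t => Real.sqrt (-deriv E t)) (Set.Ici a) ∧
    ∫ t in Set.Ici a, Real.sqrt (-deriv E t)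
      ≤ (C / (1 - θ)) * (E a - Einf) ^ (1 - θ) := by
  have hθ' : 0 < 1 - θ := sub_pos.2 hθ.2
  have hanti : AntitoneOn E (Set.Ici a) := by
    refine antitoneOn_of_deriv_nonpos (convex_Ici a)
      (fun t ht => (hdiff t ht).continuousAt.continuousWithinAt) ?_ ?_
    · exact fun t ht => (hdiff t (interior_subset ht)).differentiableWithinAt
    · exact fun t ht => hdec t (interior_subset ht)
  have key := integrableOn_Ioi_and_integral_le_of_le_deriv
    (f := fun t => Real.sqrt (-deriv E t))
    (G := fun t => -(C / (1 - θ) * (E t - Einf) ^ (1 - θ))) (a := a) (M := 0)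
    (measurable_deriv E).neg.sqrt (fun _ => Real.sqrt_nonneg _)
    (fun s hs t ht hst => by
      have hE := sub_le_sub_right (hanti hs ht hst) Einf
      have hE0 := sub_nonneg.2 (hlow t ht)
      dsimp only
      gcongr)
    (fun t ht => by
      have hE0 := sub_nonneg.2 (hlow t ht)
      rw [neg_nonpos]
      positivity)
    (fun t ht => by
      have h := sqrt_neg_deriv_le_deriv_neg_rpow (F := fun s => E s - Einf) hθ.2 hC
        ((hdiff t ht.le).sub_const Einf) (by simpa using hdec t ht.le)
        (by
          filter_upwards [lt_mem_nhds ht] with s hs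
          exact sub_nonneg.2 (hlow s hs.le))
        (by simpa using hloj t ht.le)
      simpa only [deriv_sub_const_fun] using h)
  rw [zero_sub, neg_neg] at key
  rwa [integrableOn_Ici_iff_integrableOn_Ioi, integral_Ici_eq_integral_Ioi]
end

section
/- Let a ∈ ℝ, A > 0, β > 0, and let g : [a, ∞) → [0, ∞) be measurable with ∫_τ^∞ g(t) dt ≤ A² e^{−2βτ} for every τ ≥ a. Then t ↦ √(g(t)) is integrable on [a, ∞) and for every τ ≥ a one has ∫_τ^∞ √(g(t)) dt ≤ A e^{−βτ} / (1 − e^{−β}). -/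
open MeasureTheory

/-- If `∫_s g ≤ c²` on a set of measure at most one, then `∫_s √g ≤ c`. -/
theorem lintegral_sqrt_le_of_lintegral_le_sq {α : Type*} [MeasurableSpace α] {μ : Measure α}
    {s : Set α} (hs : μ s ≤ 1) {g : α → ℝ} {c : ℝ} (hc : 0 < c)
    (hg : ∫⁻ t in s, ENNReal.ofReal (g t) ∂μ ≤ ENNReal.ofReal (c ^ 2)) :
    ∫⁻ t in s, ENNReal.ofReal √(g t) ∂μ ≤ ENNReal.ofReal c := by
  have pointwise (t : α) : ENNReal.ofReal √(g t) ≤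
      ENNReal.ofReal (c / 2) + ENNReal.ofReal (1 / (2 * c)) * ENNReal.ofReal (g t) := by
    rcases le_total (g t) 0 with h | h
    · simp [Real.sqrt_eq_zero_of_nonpos h]
    · rw [← ENNReal.ofReal_mul (by positivity), ← ENNReal.ofReal_add (by positivity) (by positivity)]
      apply ENNReal.ofReal_le_ofReal
      have key : c / 2 + 1 / (2 * c) * g t - √(g t) = (c - √(g t)) ^ 2 / (2 * c) := by
        nth_rewrite 1 [← Real.sq_sqrt h]
        field_simp
        ring
      have : 0 ≤ (c - √(g t)) ^ 2 / (2 * c) := by positivity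
      linarith
  calc ∫⁻ t in s, ENNReal.ofReal √(g t) ∂μ
      ≤ ∫⁻ t in s, (ENNReal.ofReal (c / 2) +
          ENNReal.ofReal (1 / (2 * c)) * ENNReal.ofReal (g t)) ∂μ := lintegral_mono pointwise
    _ = ENNReal.ofReal (c / 2) * μ s +
          ENNReal.ofReal (1 / (2 * c)) * ∫⁻ t in s, ENNReal.ofReal (g t) ∂μ := by
        rw [lintegral_add_left measurable_const, setLIntegral_const,
          lintegral_const_mul' _ _ ENNReal.ofReal_ne_top]
    _ ≤ ENNReal.ofReal (c / 2) * 1 +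
          ENNReal.ofReal (1 / (2 * c)) * ENNReal.ofReal (c ^ 2) := by gcongr
    _ = ENNReal.ofReal c := by
        rw [mul_one, ← ENNReal.ofReal_mul (by positivity),
          ← ENNReal.ofReal_add (by positivity) (by positivity)]
        congr 1
        field_simp
        ring

theorem Ici_subset_iUnion_Ico_add_natCast (τ : ℝ) :
    Set.Ici τ ⊆ ⋃ i : ℕ, Set.Ico (τ + i) (τ + i + 1) := by
  intro t ht
  have h : 0 ≤ t - τ := sub_nonneg.2 ht
  refine Set.mem_iUnion.2 ⟨⌊t - τ⌋₊, ?_, ?_⟩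
  · linarith [Nat.floor_le h]
  · linarith [Nat.lt_floor_add_one (t - τ)]

/-- Exponential decay of the tails of `g` passes to the tails of `√g`. -/
theorem lintegral_Ici_sqrt_le_of_exponential_decay {a A β : ℝ} (hA : 0 < A) (hβ : 0 < β)
    {g : ℝ → ℝ}
    (htail : ∀ τ, a ≤ τ →
      ∫⁻ t in Set.Ici τ, ENNReal.ofReal (g t)
        ≤ ENNReal.ofReal (A ^ 2 * Real.exp (-2 * β * τ)))
    {τ : ℝ} (hτ : a ≤ τ) :
    ∫⁻ t in Set.Ici τ, ENNReal.ofReal √(g t)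
      ≤ ENNReal.ofReal (A * Real.exp (-β * τ) / (1 - Real.exp (-β))) := by
  have hsum : HasSum (fun i : ℕ => A * Real.exp (-β * τ) * Real.exp (-β) ^ i)
      (A * Real.exp (-β * τ) / (1 - Real.exp (-β))) :=
    (hasSum_geometric_of_lt_one (Real.exp_pos _).le
      (Real.exp_lt_one_iff.2 (neg_neg_of_pos hβ))).mul_left _
  calc ∫⁻ t in Set.Ici τ, ENNReal.ofReal √(g t)
      ≤ ∫⁻ t in ⋃ i : ℕ, Set.Ico (τ + i) (τ + i + 1), ENNReal.ofReal √(g t) :=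
        lintegral_mono_set (Ici_subset_iUnion_Ico_add_natCast τ)
    _ ≤ ∑' i : ℕ, ∫⁻ t in Set.Ico (τ + i) (τ + i + 1), ENNReal.ofReal √(g t) :=
        lintegral_iUnion_le _ _
    _ ≤ ∑' i : ℕ, ENNReal.ofReal (A * Real.exp (-β * τ) * Real.exp (-β) ^ i) := by
        refine ENNReal.tsum_le_tsum fun i => ?_
        refine lintegral_sqrt_le_of_lintegral_le_sq (by simp) (by positivity) ?_
        refine (lintegral_mono_set Set.Ico_subset_Ici_self).trans
          ((htail (τ + i) (hτ.trans (by simp))).trans_eq ?_)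
        rw [mul_assoc A, mul_pow A, ← Real.exp_nat_mul, ← Real.exp_add, ← Real.exp_nat_mul]
        congr 3
        push_cast
        ring
    _ = ENNReal.ofReal (A * Real.exp (-β * τ) / (1 - Real.exp (-β))) := by
        rw [← ENNReal.ofReal_tsum_of_nonneg (fun i => by positivity) hsum.summable,
          hsum.tsum_eq]

/-- If the tails of a nonnegative measurable `g` on `[a,∞)` decay like
`∫_τ^∞ g ≤ A² e^{−2βτ}`, then `√g` is integrable on `[a,∞)` and
`∫_τ^∞ √g ≤ A e^{−βτ}/(1 − e^{−β})` for every `τ ≥ a`. -/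
theorem sqrt_tail_bound_from_exponential_decay
    (a A β : ℝ) (hA : 0 < A) (hβ : 0 < β) (g : ℝ → ℝ)
    (hmeas : Measurable g)
    (hnn : ∀ t, a ≤ t → 0 ≤ g t)
    (htail : ∀ τ, a ≤ τ →
      ∫⁻ t in Set.Ici τ, ENNReal.ofReal (g t)
        ≤ ENNReal.ofReal (A ^ 2 * Real.exp (-2 * β * τ))) :
    IntegrableOn (fun t => Real.sqrt (g t)) (Set.Ici a) ∧
    ∀ τ, a ≤ τ →
      ∫ t in Set.Ici τ, Real.sqrt (g t)
        ≤ A * Real.exp (-β * τ) / (1 - Real.exp (-β)) := by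
  have hsqrt : Measurable fun t => √(g t) := hmeas.sqrt
  have hnonneg (τ : ℝ) : 0 ≤ᵐ[volume.restrict (Set.Ici τ)] fun t => √(g t) :=
    Filter.Eventually.of_forall fun t => Real.sqrt_nonneg _
  refine ⟨⟨hsqrt.aestronglyMeasurable, ?_⟩, fun τ hτ => ?_⟩
  · rw [hasFiniteIntegral_iff_ofReal (hnonneg a)]
    exact (lintegral_Ici_sqrt_le_of_exponential_decay hA hβ htail le_rfl).trans_lt
      ENNReal.ofReal_lt_top
  · have hden : 0 < 1 - Real.exp (-β) := sub_pos.2 (Real.exp_lt_one_iff.2 (neg_neg_of_pos hβ))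
    rw [integral_eq_lintegral_of_nonneg_ae (hnonneg τ) hsqrt.aestronglyMeasurable]
    exact ENNReal.toReal_le_of_le_ofReal (by positivity)
      (lintegral_Ici_sqrt_le_of_exponential_decay hA hβ htail hτ)
end

section
/- For every natural number k and every λ > 0 there exists a constant C = C(k, λ) > 0 such that for all s > 0 and all L ≥ 1, the k-th derivative of the function r ↦ log(1 + s²/(λ² r²)) evaluated at r = L s satisfies |d^k/dr^k [log(1 + s²/(λ² r²))]|_{r = Ls}| ≤ C / (L^{k+2} s^k). -/
theorem hasDerivAt_zpow_mul_inv_sq_add_pow {a r : ℝ} (ha : 0 < a) (hr : 0 < r) (m : ℤ) (j : ℕ) :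
    HasDerivAt (fun x : ℝ => x ^ m * ((x ^ 2 + a)⁻¹) ^ j)
      (m * (r ^ (m - 1) * ((r ^ 2 + a)⁻¹) ^ j)
        + (-2 * j) * (r ^ (m + 1) * ((r ^ 2 + a)⁻¹) ^ (j + 1))) r := by
  have hq : r ^ 2 + a ≠ 0 := by positivity
  have h1 := hasDerivAt_zpow m r (Or.inl hr.ne')
  have h2 : HasDerivAt (fun x : ℝ => x ^ 2 + a) (2 * r) r := by
    simpa using (hasDerivAt_pow 2 r).add_const a
  refine (h1.mul ((h2.fun_inv hq).fun_pow j)).congr_deriv ?_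
  rw [zpow_add_one₀ hr.ne']
  rcases j with _ | j
  · simp
  · simp only [Nat.add_sub_cancel, pow_succ]
    push_cast
    field_simp

theorem contDiffAt_zpow_mul_inv_sq_add_pow {a r : ℝ} (ha : 0 < a) (hr : 0 < r) (m : ℤ) (j n : ℕ) :
    ContDiffAt ℝ n (fun x : ℝ => x ^ m * ((x ^ 2 + a)⁻¹) ^ j) r := by
  have hq : r ^ 2 + a ≠ 0 := by positivity
  have hz : ContDiffAt ℝ n (fun x : ℝ => x ^ m) r := by
    cases m with
    | ofNat m => simpa using contDiffAt_id.pow m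
    | negSucc m =>
      simp only [zpow_negSucc]
      exact (contDiffAt_id.pow (m + 1)).inv (pow_ne_zero (m + 1) hr.ne')
  exact hz.mul ((((contDiffAt_id.pow 2).add contDiffAt_const).inv hq).pow j)

/-- The iterated derivatives of `x ^ m / (x ^ 2 + a) ^ j` obey scale-invariant bounds, uniformly in
`a > 0`. -/
theorem exists_abs_iteratedDeriv_zpow_mul_inv_sq_add_pow_le (n : ℕ) (m : ℤ) (j : ℕ) :
    ∃ C : ℝ, 0 < C ∧ ∀ a r : ℝ, 0 < a → 0 < r →
      |iteratedDeriv n (fun x : ℝ => x ^ m * ((x ^ 2 + a)⁻¹) ^ j) r|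
        ≤ C * (r ^ (m - n) * ((r ^ 2 + a)⁻¹) ^ j) := by
  induction n generalizing m j with
  | zero =>
    refine ⟨1, one_pos, fun a r ha hr => ?_⟩
    simp only [iteratedDeriv_zero, Nat.cast_zero, sub_zero, one_mul]
    exact (abs_of_pos (by positivity)).le
  | succ n ih =>
    obtain ⟨C₁, hC₁, h₁⟩ := ih (m - 1) j
    obtain ⟨C₂, hC₂, h₂⟩ := ih (m + 1) (j + 1)
    refine ⟨|(m : ℝ)| * C₁ + 2 * j * C₂ + 1, by positivity, fun a r ha hr => ?_⟩
    have hq : 0 < r ^ 2 + a := by positivity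
    have hderiv : deriv (fun x : ℝ => x ^ m * ((x ^ 2 + a)⁻¹) ^ j) =ᶠ[nhds r] fun x =>
        m * (x ^ (m - 1) * ((x ^ 2 + a)⁻¹) ^ j)
          + (-2 * j) * (x ^ (m + 1) * ((x ^ 2 + a)⁻¹) ^ (j + 1)) := by
      filter_upwards [lt_mem_nhds hr] with x hx
      exact (hasDerivAt_zpow_mul_inv_sq_add_pow ha hx m j).deriv
    rw [iteratedDeriv_succ', hderiv.iteratedDeriv_eq n,
      iteratedDeriv_fun_add
        (contDiffAt_const.mul (contDiffAt_zpow_mul_inv_sq_add_pow ha hr _ _ n))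
        (contDiffAt_const.mul (contDiffAt_zpow_mul_inv_sq_add_pow ha hr _ _ n)),
      iteratedDeriv_const_mul_field, iteratedDeriv_const_mul_field]
    set T := r ^ (m - (n + 1 : ℕ)) * ((r ^ 2 + a)⁻¹) ^ j with hT
    have hTpos : 0 < T := by positivity
    have e₁ : r ^ (m - 1 - n) * ((r ^ 2 + a)⁻¹) ^ j = T := by
      rw [hT]; congr 2; push_cast; ring
    have e₂ : r ^ (m + 1 - n) * ((r ^ 2 + a)⁻¹) ^ (j + 1) ≤ T := by
      have : r ^ (m + 1 - n) = r ^ (m - (n + 1 : ℕ)) * r ^ 2 := by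
        rw [← zpow_natCast r 2, ← zpow_add₀ hr.ne']; congr 1; push_cast; ring
      calc r ^ (m + 1 - n) * ((r ^ 2 + a)⁻¹) ^ (j + 1) = T * (r ^ 2 / (r ^ 2 + a)) := by
            rw [this, hT, pow_succ]; ring
        _ ≤ T * 1 := by
            gcongr
            rw [div_le_one hq]
            linarith
        _ = T := mul_one T
    have b₁ := h₁ a r ha hr
    have b₂ := (h₂ a r ha hr).trans (mul_le_mul_of_nonneg_left e₂ hC₂.le)
    rw [e₁] at b₁
    refine (abs_add_le _ _).trans ?_
    rw [abs_mul, abs_mul]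
    have hj : |(-2 * j : ℝ)| = 2 * j := by rw [abs_mul, abs_neg, abs_two, Nat.abs_cast]
    rw [hj]
    have c₁ := mul_le_mul_of_nonneg_left b₁ (abs_nonneg (m : ℝ))
    have c₂ := mul_le_mul_of_nonneg_left b₂ (by positivity : (0 : ℝ) ≤ 2 * j)
    linarith

theorem hasDerivAt_log_one_add_div_sq {s lam r : ℝ} (hs : 0 < s) (hlam : 0 < lam) (hr : 0 < r) :
    HasDerivAt (fun r : ℝ => Real.log (1 + s ^ 2 / (lam ^ 2 * r ^ 2)))
      (-2 * (s ^ 2 / lam ^ 2) * (r ^ (-1 : ℤ) * ((r ^ 2 + s ^ 2 / lam ^ 2)⁻¹) ^ 1)) r := by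
  have h1 : HasDerivAt (fun x : ℝ => lam ^ 2 * x ^ 2) (lam ^ 2 * (2 * r)) r := by
    simpa using (hasDerivAt_pow 2 r).const_mul (lam ^ 2)
  have h2 := (((hasDerivAt_const r (s ^ 2)).fun_div h1 (by positivity)).const_add 1).log
    (by positivity)
  refine h2.congr_deriv ?_
  rw [zpow_neg_one]
  field_simp
  ring

/-- Bounds for the Taylor coefficients of the test function: for every `k` and
`λ > 0` there is `C = C(k,λ) > 0` such that for all `s > 0` and `L ≥ 1`,
`|d^k/dr^k log(1 + s²/(λ²r²)) |_{r=Ls}| ≤ C / (L^{k+2} s^k)`. -/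
theorem taylor_coefficient_bound (k : ℕ) (lam : ℝ) (hlam : 0 < lam) :
    ∃ C : ℝ, 0 < C ∧ ∀ s L : ℝ, 0 < s → 1 ≤ L →
      |iteratedDeriv k (fun r : ℝ => Real.log (1 + s ^ 2 / (lam ^ 2 * r ^ 2))) (L * s)|
        ≤ C / (L ^ (k + 2) * s ^ k) := by
  rcases k with _ | n
  · refine ⟨1 / lam ^ 2, by positivity, fun s L hs hL => ?_⟩
    have hL' : 0 < L := by linarith
    have hx : 0 < s ^ 2 / (lam ^ 2 * (L * s) ^ 2) := by positivity
    rw [iteratedDeriv_zero, abs_of_nonneg (Real.log_nonneg (by linarith))]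
    refine (Real.log_le_sub_one_of_pos (by positivity)).trans (le_of_eq ?_)
    field_simp
    ring
  · obtain ⟨C, hC, h⟩ := exists_abs_iteratedDeriv_zpow_mul_inv_sq_add_pow_le n (-1) 1
    refine ⟨2 * C / lam ^ 2, by positivity, fun s L hs hL => ?_⟩
    have hL' : 0 < L := by linarith
    have hr : 0 < L * s := by positivity
    have ha : 0 < s ^ 2 / lam ^ 2 := by positivity
    have hderiv : deriv (fun r : ℝ => Real.log (1 + s ^ 2 / (lam ^ 2 * r ^ 2)))
        =ᶠ[nhds (L * s)] fun r => -2 * (s ^ 2 / lam ^ 2) *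
          (r ^ (-1 : ℤ) * ((r ^ 2 + s ^ 2 / lam ^ 2)⁻¹) ^ 1) := by
      filter_upwards [lt_mem_nhds hr] with x hx
      exact (hasDerivAt_log_one_add_div_sq hs hlam hx).deriv
    rw [iteratedDeriv_succ', hderiv.iteratedDeriv_eq n, iteratedDeriv_const_mul_field, abs_mul,
      neg_mul, abs_neg, abs_of_pos (by positivity : 0 < 2 * (s ^ 2 / lam ^ 2))]
    have hz : (L * s) ^ (-1 - n : ℤ) = ((L * s) ^ (n + 1))⁻¹ := by
      rw [← zpow_natCast, ← zpow_neg]; congr 1; push_cast; ring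
    calc 2 * (s ^ 2 / lam ^ 2) * _
        ≤ 2 * (s ^ 2 / lam ^ 2) *
          (C * ((L * s) ^ (-1 - n : ℤ) * (((L * s) ^ 2 + s ^ 2 / lam ^ 2)⁻¹) ^ 1)) := by
          gcongr
          exact h _ _ ha hr
      _ ≤ 2 * (s ^ 2 / lam ^ 2) * (C * (((L * s) ^ (n + 1))⁻¹ * ((L * s) ^ 2)⁻¹)) := by
          rw [hz, pow_one]
          gcongr
          linarith
      _ = 2 * C / lam ^ 2 / (L ^ (n + 1 + 2) * s ^ (n + 1)) := by
          simp only [mul_pow, pow_add]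
          field_simp
end
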